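/- Let p be a prime, let G be a finite p-group, let L be its lattice of normal subgroups (ordered by inclusion), and let {e} = N_0 < N_1 < ⋯ < N_n = G be the increasing enumeration of all elements of L that cut L. Then the clone Comp(G) of congruence preserving functions of G is finitely generated if and only if for each i ∈ {0,…,n−1}, the interval I[N_i, N_{i+1}] of L either contains exactly two elements or does not split. -/

import Mathlib

/-- A finitary operation on `A`. -/
abbrev FinOp (A : Type*) := Σ n : ℕ, (Fin n → A) → A

/-- Membership in the clone generated by a set `F` of finitary operations:
the smallest set of finitary operations containing `F` and all projections
and closed under composition. -/
inductive InClone {A : Type*} (F : Set (FinOp A)) : {n : ℕ} → ((Fin n → A) → A) → Prop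
  | proj {n : ℕ} (i : Fin n) : InClone F fun x => x i
  | base {n : ℕ} (f : (Fin n → A) → A) : (⟨n, f⟩ : FinOp A) ∈ F → InClone F f
  | comp {n m : ℕ} (f : (Fin m → A) → A) (g : Fin m → (Fin n → A) → A) :
      InClone F f → (∀ i, InClone F (g i)) → InClone F fun x => f fun i => g i x

/-- A function `G^k → G` is compatible (congruence preserving): it preserves
every congruence, i.e. for every normal subgroup `N` and tuples `a ≡ b mod N`
one has `f a ≡ f b mod N`. -/
def Compatible {G : Type*} [Group G] {k : ℕ} (f : (Fin k → G) → G) : Prop :=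
  ∀ N : Subgroup G, N.Normal → ∀ a b : Fin k → G,
    (∀ i, (a i)⁻¹ * b i ∈ N) → (f a)⁻¹ * f b ∈ N

/-- The clone `Comp G` of congruence preserving functions of `G` is finitely
generated: some finite set of compatible functions generates, as a clone,
exactly the compatible functions (of all arities `≥ 1`). -/
def CompFG (G : Type*) [Group G] : Prop :=
  ∃ F : Set (FinOp G), F.Finite ∧ (∀ f ∈ F, 1 ≤ f.1 ∧ Compatible f.2) ∧
    ∀ (n : ℕ), 1 ≤ n → ∀ f : (Fin n → G) → G, (Compatible f ↔ InClone F f)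

/-- The lattice of normal subgroups of `G`. -/
instance NormalSubgroup.instLattice {G : Type*} [Group G] :
    Lattice {N : Subgroup G // N.Normal} :=
  Subtype.lattice (fun _ _ hA hB => @Subgroup.sup_normal _ _ _ _ hA hB)
    (fun _ _ hA hB => @Subgroup.normal_inf_normal _ _ _ _ hA hB)

instance NormalSubgroup.instBoundedOrder {G : Type*} [Group G] :
    BoundedOrder {N : Subgroup G // N.Normal} where
  top := ⟨⊤, inferInstance⟩
  le_top A := (le_top : A.1 ≤ ⊤)
  bot := ⟨⊥, inferInstance⟩
  bot_le A := (bot_le : ⊥ ≤ A.1)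

/-- `β` cuts the lattice: every element is comparable with `β`. -/
def Cuts {L : Type*} [Lattice L] (β : L) : Prop := ∀ α : L, α ≤ β ∨ β ≤ α

/-- The interval `I[a,b]` splits: it has a splitting pair `(δ, ε)`. -/
def IntervalSplits {L : Type*} [Lattice L] (a b : L) : Prop :=
  ∃ δ ε : L, a ≤ δ ∧ δ < b ∧ a < ε ∧ ε ≤ b ∧
    ∀ K : L, a ≤ K → K ≤ b → K ≤ δ ∨ ε ≤ K

section ModularLattice

variable {L : Type*} [Lattice L]

/-- Any two distinct covers of an element have a common relative complement below their join. -/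
def CoversHaveThird (L : Type*) [Lattice L] : Prop :=
  ∀ ⦃c x y : L⦄, c ⋖ x → c ⋖ y → x ≠ y →
    ∃ d, d ≤ x ⊔ y ∧ x ⊓ d = c ∧ y ⊓ d = c ∧ x ⊔ d = y ⊔ d

/-- No element strictly between `a` and `b` is comparable with the whole interval. -/
def NoInnerCut (a b : L) : Prop :=
  ∀ z, a < z → z < b → ∃ k, a ≤ k ∧ k ≤ b ∧ ¬ k ≤ z ∧ ¬ z ≤ k

theorem exists_covBy_inf_of_incomparable [Finite L] {a k z : L} (hak : a ≤ k) (haz : a ≤ z)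
    (hkz : ¬ k ≤ z) (hzk : ¬ z ≤ k) :
    ∃ x y, x ≤ k ∧ y ≤ z ∧ a ≤ x ⊓ z ∧ ¬ x ≤ z ∧ x ⊓ z ⋖ x ∧ x ⊓ z ⋖ y ∧ x ≠ y := by
  obtain ⟨x, ⟨⟨hax, hxk, hxz⟩, hmin⟩⟩ := exists_minimal_of_wellFoundedLT
    (fun x => a ≤ x ∧ x ≤ k ∧ ¬ x ≤ z) ⟨k, hak, le_rfl, hkz⟩
  have hlt : x ⊓ z < z := lt_of_le_of_ne inf_le_right fun h =>
    hzk ((inf_eq_right.1 h).trans hxk)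
  obtain ⟨y, hy, hyz⟩ := exists_covBy_le_of_lt hlt
  refine ⟨x, y, hxk, hyz, le_inf hax haz, hxz, ⟨?_, ?_⟩, hy, ?_⟩
  · exact lt_of_le_of_ne inf_le_left fun h => hxz (inf_eq_left.1 h)
  · intro w h1 h2
    by_cases hw : w ≤ z
    · exact h1.not_ge (le_inf h2.le hw)
    · exact h2.not_ge (hmin ⟨(le_inf hax haz).trans h1.le, h2.le.trans hxk, hw⟩ h2.le)
  · rintro rfl
    exact hxz hyz

variable [IsModularLattice L] [Finite L]

/-- A predicate on prime quotients of `[a, b]` that is invariant under transposition is constant,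
provided that the interval has no inner cutting element. -/
theorem covBy_predicate_constant (h3 : CoversHaveThird L) {a b : L} (hcut : NoInnerCut a b)
    (P : L → L → Prop)
    (hP : ∀ c' c d' d, a ≤ c' → d ≤ b → c ⊓ d' = c' → c ⊔ d' = d → (P c' c ↔ P d' d))
    {c' c d' d : L} (hc : a ≤ c') (hc1 : c' ⋖ c) (hc2 : c ≤ b)
    (hd : a ≤ d') (hd1 : d' ⋖ d) (hd2 : d ≤ b) (h : P c' c) : P d' d := by
  have hab : a < b := (hc.trans_lt hc1.lt).trans_le hc2
  have hM3 : ∀ ⦃c x y : L⦄, a ≤ c → x ≤ b → y ≤ b → c ⋖ x → c ⋖ y → x ≠ y →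
      (P c x ↔ P c y) := by
    intro c x y hac hx hy hcx hcy hxy
    obtain ⟨d, hd, h1, h2, h4⟩ := h3 hcx hcy hxy
    have hdb : d ≤ b := hd.trans (sup_le hx hy)
    rw [hP c x d (x ⊔ d) hac (sup_le hx hdb) h1 rfl,
      hP c y d (x ⊔ d) hac (sup_le hx hdb) h2 h4.symm]
  obtain ⟨x, hax, hxb⟩ := exists_covBy_le_of_lt hab
  obtain ⟨T, ⟨⟨hxT, hTb, hgood⟩, hmax⟩⟩ := exists_maximal_of_wellFoundedGT
    (fun T => x ≤ T ∧ T ≤ b ∧ ∀ c' c, a ≤ c' → c' ⋖ c → c ≤ T → (P c' c ↔ P a x))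
    ⟨x, le_rfl, hxb, by
      intro c' c h1 h2 h4
      have hc' : a = c' := by
        by_contra hne
        exact hax.2 (lt_of_le_of_ne h1 hne) (h2.lt.trans_le h4)
      subst hc'
      rw [(hax.eq_or_eq h2.le h4).resolve_left h2.lt.ne']⟩
  have hT : T = b := by
    by_contra hne
    obtain ⟨k, k1, k2, k3, k4⟩ := hcut T (hax.lt.trans_le hxT) (lt_of_le_of_ne hTb hne)
    obtain ⟨u, v, hu, hv, hau, huT, huc, hvc, huv⟩ :=
      exists_covBy_inf_of_incomparable k1 (hax.le.trans hxT) k3 k4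
    have hub := hu.trans k2
    have huP : P (u ⊓ T) u ↔ P a x :=
      (hM3 hau hub (hv.trans hTb) huc hvc huv).trans (hgood _ _ hau hvc hv)
    have hTP : P T (u ⊔ T) ↔ P a x :=
      (hP _ _ T (u ⊔ T) hau (sup_le hub hTb) rfl rfl).symm.trans huP
    have hTc : T ⋖ u ⊔ T := covBy_sup_of_inf_covBy_left huc
    refine hTc.lt.not_ge (hmax ⟨hxT.trans hTc.le, sup_le hub hTb, ?_⟩ hTc.le)
    intro e' e h1 h2 h4
    have heb : e ≤ b := h4.trans (sup_le hub hTb)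
    have haT : a ≤ T := hax.le.trans hxT
    by_cases he : e ⊓ T ≤ e'
    · have heT : ¬ e ≤ T := fun h => h2.lt.not_ge ((le_inf le_rfl h).trans he)
      have heT2 : e ⊔ T = u ⊔ T := by
        rcases hTc.eq_or_eq (le_sup_right : T ≤ e ⊔ T) (sup_le h4 hTc.le) with h | h
        · exact absurd (sup_eq_right.1 h) heT
        · exact h
      have heT' : e' ≤ T := by
        rcases hTc.eq_or_eq (le_sup_right : T ≤ e' ⊔ T) (sup_le (h2.le.trans h4) hTc.le) with h | h
        · exact sup_eq_right.1 h
        · exfalso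
          have : (e' ⊔ T) ⊓ e = e' ⊔ T ⊓ e := (sup_inf_assoc_of_le T h2.le)
          rw [h, inf_eq_right.2 h4, inf_comm, sup_eq_left.2 he] at this
          exact h2.lt.ne this.symm
      rw [hP e' e T (u ⊔ T) h1 (sup_le hub hTb) (le_antisymm he (le_inf h2.le heT')) heT2]
      exact hTP
    · have hsup : (e ⊓ T) ⊔ e' = e := by
        rcases h2.eq_or_eq (le_sup_right : e' ≤ (e ⊓ T) ⊔ e') (sup_le inf_le_left h2.le) with h | h
        · exact absurd (sup_eq_right.1 h) he
        · exact h
      have hinf : (e ⊓ T) ⊓ e' = T ⊓ e' := by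
        rw [inf_comm e T, inf_assoc, inf_eq_right.2 h2.le]
      have hcov : T ⊓ e' ⋖ e ⊓ T := by
        rw [← hinf]
        apply inf_covBy_of_covBy_sup_right
        rw [hsup]; exact h2
      rw [← hP (T ⊓ e') (e ⊓ T) e' e (le_inf haT h1) heb hinf hsup]
      exact hgood _ _ (le_inf haT h1) hcov inf_le_right
  subst hT
  exact (hgood _ _ hd hd1 hd2).2 ((hgood _ _ hc hc1 hc2).1 h)

end ModularLattice

section Compatible

variable {G : Type*} [Group G]

theorem compatible_iff_mk_eq {k : ℕ} {f : (Fin k → G) → G} :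
    Compatible f ↔ ∀ N : Subgroup G, N.Normal → ∀ a b : Fin k → G,
      (∀ i, (a i : G ⧸ N) = b i) → (f a : G ⧸ N) = f b := by
  simp only [Compatible, QuotientGroup.eq]

theorem Compatible.mk_eq {k : ℕ} {f : (Fin k → G) → G} (hf : Compatible f) (N : Subgroup G)
    [hN : N.Normal] {a b : Fin k → G} (h : ∀ i, (a i : G ⧸ N) = b i) : (f a : G ⧸ N) = f b :=
  compatible_iff_mk_eq.1 hf N hN a b h

theorem compatible_const {k : ℕ} (c : G) : Compatible fun _ : Fin k → G => c :=
  compatible_iff_mk_eq.2 fun _ _ _ _ _ => rfl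

theorem compatible_proj {k : ℕ} (i : Fin k) : Compatible fun x : Fin k → G => x i :=
  compatible_iff_mk_eq.2 fun _ _ _ _ h => h i

theorem Compatible.comp {k m : ℕ} {f : (Fin m → G) → G} {g : Fin m → (Fin k → G) → G}
    (hf : Compatible f) (hg : ∀ i, Compatible (g i)) : Compatible fun x => f fun i => g i x :=
  compatible_iff_mk_eq.2 fun N _ _ _ h => hf.mk_eq N fun i => (hg i).mk_eq N h

theorem Compatible.mul {k : ℕ} {f g : (Fin k → G) → G} (hf : Compatible f) (hg : Compatible g) :
    Compatible fun x => f x * g x :=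
  compatible_iff_mk_eq.2 fun N _ a b h => by
    rw [QuotientGroup.mk_mul, QuotientGroup.mk_mul, hf.mk_eq N h, hg.mk_eq N h]

theorem Compatible.inv {k : ℕ} {f : (Fin k → G) → G} (hf : Compatible f) :
    Compatible fun x => (f x)⁻¹ :=
  compatible_iff_mk_eq.2 fun N _ a b h => by
    rw [QuotientGroup.mk_inv, QuotientGroup.mk_inv, hf.mk_eq N h]

theorem Compatible.update {k : ℕ} {f : (Fin k → G) → G} (hf : Compatible f) (j : Fin k)
    {g : (Fin k → G) → G} (hg : Compatible g) :
    Compatible fun x => f (Function.update x j (g x)) := by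
  refine hf.comp (g := fun i x => Function.update x j (g x) i) fun i => ?_
  by_cases h : i = j
  · subst h; simpa using hg
  · simpa [Function.update_of_ne h] using compatible_proj i

theorem InClone.compatible {F : Set (FinOp G)} (hF : ∀ f ∈ F, Compatible f.2) {k : ℕ}
    {f : (Fin k → G) → G} (h : InClone F f) : Compatible f := by
  induction h with
  | proj i => exact compatible_proj i
  | base f hf => exact hF _ hf
  | comp f g _ _ ihf ihg => exact ihf.comp ihg

/-- The compatible operations of arity between `1` and `M`. -/
def compatibleOps (G : Type*) [Group G] (M : ℕ) : Set (FinOp G) :=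
  {f | 1 ≤ f.1 ∧ f.1 ≤ M ∧ Compatible f.2}

theorem finite_compatibleOps [Finite G] (M : ℕ) : (compatibleOps G M).Finite := by
  refine (Set.finite_range
    fun q : Σ n : Fin (M + 1), ((Fin n → G) → G) => (⟨q.1, q.2⟩ : FinOp G)).subset ?_
  rintro ⟨n, f⟩ ⟨-, h, -⟩
  exact ⟨⟨⟨n, Nat.lt_succ_of_le h⟩, f⟩, rfl⟩

variable {M : ℕ}

theorem Compatible.inClone_of_le {k : ℕ} {f : (Fin k → G) → G} (hf : Compatible f) (hk : 1 ≤ k)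
    (hkM : k ≤ M) : InClone (compatibleOps G M) f :=
  .base f ⟨hk, hkM, hf⟩

theorem InClone.comp₂ {A : Type*} {F : Set (FinOp A)} {k : ℕ} {h : (Fin 2 → A) → A}
    {f g : (Fin k → A) → A}
    (hh : InClone F h) (hf : InClone F f) (hg : InClone F g) :
    InClone F fun x => h ![f x, g x] := by
  have := InClone.comp h ![f, g] hh (by intro i; fin_cases i <;> assumption)
  convert this using 3 with x
  ext i; fin_cases i <;> rfl

theorem InClone.mul (hM : 2 ≤ M) {k : ℕ} {f g : (Fin k → G) → G}
    (hf : InClone (compatibleOps G M) f) (hg : InClone (compatibleOps G M) g) :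
    InClone (compatibleOps G M) fun x => f x * g x :=
  InClone.comp₂ (h := fun x => x 0 * x 1)
    (((compatible_proj 0).mul (compatible_proj 1)).inClone_of_le one_le_two hM) hf hg

theorem inClone_const (hM : 2 ≤ M) {k : ℕ} (hk : 1 ≤ k) (c : G) :
    InClone (compatibleOps G M) fun _ : Fin k → G => c :=
  InClone.comp (fun _ : Fin 1 → G => c) (fun _ x => x ⟨0, hk⟩)
    ((compatible_const c).inClone_of_le le_rfl (by omega)) fun _ => .proj _

open Classical in
/-- The binary operation that returns its second argument if the first one lies in `c * E` and the
second one in `B`, and `1` otherwise. -/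
noncomputable def selector (E B : Subgroup G) (c : G) (x : Fin 2 → G) : G :=
  if c⁻¹ * x 0 ∈ E ∧ x 1 ∈ B then x 1 else 1

theorem selector_mem (E B : Subgroup G) (c : G) (x : Fin 2 → G) : selector E B c x ∈ B := by
  unfold selector
  split_ifs with h
  exacts [h.2, B.one_mem]

theorem compatible_selector {E B : Subgroup G} (hEB : E ≤ B)
    (hB : ∀ N : Subgroup G, N.Normal → N ≤ E ∨ B ≤ N) (c : G) :
    Compatible (selector E B c) := by
  intro N hN a b h
  rcases hB N hN with hNE | hBN
  · have h1 : c⁻¹ * a 0 ∈ E ↔ c⁻¹ * b 0 ∈ E := by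
      rw [← E.mul_mem_cancel_right (hNE (h 0))]; group
    have h2 : a 1 ∈ B ↔ b 1 ∈ B := by
      rw [← B.mul_mem_cancel_right (hEB (hNE (h 1)))]; group
    unfold selector
    by_cases hab : c⁻¹ * b 0 ∈ E ∧ b 1 ∈ B
    · rw [if_pos hab, if_pos ⟨h1.2 hab.1, h2.2 hab.2⟩]
      exact h 1
    · rw [if_neg hab, if_neg fun h => hab ⟨h1.1 h.1, h2.1 h.2⟩]
      simp
  · exact hBN (B.mul_mem (B.inv_mem (selector_mem ..)) (selector_mem ..))

theorem exists_inClone_selected {E B : Subgroup G}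
    (hsel : ∀ c, InClone (compatibleOps G M) (selector E B c)) {k : ℕ} (hk : 1 ≤ k)
    (c : Fin k → G) {g : (Fin k → G) → G} (hg : InClone (compatibleOps G M) g)
    (hgB : ∀ x, (∀ i, (c i)⁻¹ * x i ∈ E) → g x ∈ B) :
    ∃ h, InClone (compatibleOps G M) h ∧ (∀ x, (∀ i, (c i)⁻¹ * x i ∈ E) → h x = g x) ∧
      ∀ x, (¬ ∀ i, (c i)⁻¹ * x i ∈ E) → h x = 1 := by
  have key : ∀ J : Finset (Fin k), J.Nonempty → ∃ h, InClone (compatibleOps G M) h ∧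
      (∀ x, (∀ i, (c i)⁻¹ * x i ∈ E) → h x = g x) ∧
      ∀ x, (∃ i ∈ J, (c i)⁻¹ * x i ∉ E) → h x = 1 := by
    have step : ∀ (j : Fin k) (h : (Fin k → G) → G), InClone (compatibleOps G M) h →
        (∀ x, (∀ i, (c i)⁻¹ * x i ∈ E) → h x = g x) →
        ∃ h', InClone (compatibleOps G M) h' ∧ (∀ x, (∀ i, (c i)⁻¹ * x i ∈ E) → h' x = g x) ∧
          ∀ x, ((c j)⁻¹ * x j ∉ E ∨ h x = 1) → h' x = 1 := by
      intro j h hh hhg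
      refine ⟨_, (hsel (c j)).comp₂ (.proj j) hh, fun x hx => ?_, fun x hx => ?_⟩
      · have := hgB x hx
        simp [selector, hx j, hhg x hx, this]
      · simp only [selector]
        split_ifs with h
        · exact hx.resolve_left fun hn => hn h.1
        · rfl
    intro J hJ
    induction hJ using Finset.Nonempty.cons_induction with
    | singleton j =>
      obtain ⟨h, h1, h2, h3⟩ := step j g hg fun _ _ => rfl
      exact ⟨h, h1, h2, fun x hx => h3 x (.inl (by simpa using hx))⟩
    | cons j J hj hJ ih =>
      obtain ⟨h, h1, h2, h3⟩ := ih
      obtain ⟨h', h1', h2', h3'⟩ := step j h h1 h2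
      refine ⟨h', h1', h2', fun x hx => h3' x ?_⟩
      simp only [Finset.mem_cons, exists_eq_or_imp] at hx
      exact hx.imp_right (h3 x)
  obtain ⟨h, h1, h2, h3⟩ := key Finset.univ ⟨⟨0, hk⟩, Finset.mem_univ _⟩
  exact ⟨h, h1, h2, fun x hx => h3 x (by simpa using hx)⟩

/-- Operations with values in `B` can be interpolated modulo `A` once they can be interpolated
modulo `A` on each coset of a power of `E`, provided that the selectors are available. -/
theorem exists_inClone_of_local [Finite G] {A E B : Subgroup G} (hAB : A ≤ B) (hM : 2 ≤ M)
    (hsel : ∀ c, InClone (compatibleOps G M) (selector E B c)) {k : ℕ} (hk : 1 ≤ k)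
    {r : (Fin k → G) → G} (hr : ∀ x, r x ∈ B)
    (hloc : ∀ c : Fin k → G, ∃ g, InClone (compatibleOps G M) g ∧
      ∀ x, (∀ i, (c i)⁻¹ * x i ∈ E) → (g x)⁻¹ * r x ∈ A) :
    ∃ g, InClone (compatibleOps G M) g ∧ ∀ x, (g x)⁻¹ * r x ∈ A := by
  classical
  have key : ∀ S : Finset (Fin k → G), ∃ g, InClone (compatibleOps G M) g ∧
      (∀ x, (∃ c ∈ S, ∀ i, (c i)⁻¹ * x i ∈ E) → (g x)⁻¹ * r x ∈ A) ∧
      ∀ x, (¬ ∃ c ∈ S, ∀ i, (c i)⁻¹ * x i ∈ E) → g x = 1 := by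
    intro S
    induction S using Finset.induction_on with
    | empty => exact ⟨_, inClone_const hM hk 1, by simp, by simp⟩
    | insert c S hc ih =>
      obtain ⟨g, hg, hg1, hg2⟩ := ih
      by_cases hcS : ∃ d ∈ S, ∀ i, (d i)⁻¹ * c i ∈ E
      · have hiff : ∀ x : Fin k → G, (∃ d ∈ insert c S, ∀ i, (d i)⁻¹ * x i ∈ E) ↔
            ∃ d ∈ S, ∀ i, (d i)⁻¹ * x i ∈ E := by
          intro x
          simp only [Finset.mem_insert, exists_eq_or_imp, or_iff_right_iff_imp]
          intro hx
          obtain ⟨d, hd, hdc⟩ := hcS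
          refine ⟨d, hd, fun i => ?_⟩
          simpa [mul_assoc] using E.mul_mem (hdc i) (hx i)
        simp only [hiff]
        exact ⟨g, hg, hg1, hg2⟩
      · obtain ⟨g', hg', hg'r⟩ := hloc c
        obtain ⟨h, hh, h1, h2⟩ := exists_inClone_selected hsel hk c hg' (by
          intro x hx
          have := B.mul_mem (hr x) (B.inv_mem (hAB (hg'r x hx)))
          simpa using this)
        refine ⟨_, InClone.mul hM hg hh, fun x hx => ?_, fun x hx => ?_⟩
        · simp only [Finset.mem_insert, exists_eq_or_imp] at hx
          by_cases hxc : ∀ i, (c i)⁻¹ * x i ∈ E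
          · rw [hg2, h1 x hxc, one_mul]
            · exact hg'r x hxc
            · rintro ⟨d, hd, hdx⟩
              refine hcS ⟨d, hd, fun i => ?_⟩
              simpa [mul_assoc] using E.mul_mem (hdx i) (E.inv_mem (hxc i))
          · rw [h2 x hxc, mul_one]
            exact hg1 x (hx.resolve_left hxc)
        · simp only [Finset.mem_insert, exists_eq_or_imp, not_or] at hx
          rw [hg2 x hx.2, h2 x hx.1, one_mul]
  have := Fintype.ofFinite (Fin k → G)
  obtain ⟨g, hg, hg1, -⟩ := key Finset.univ
  exact ⟨g, hg, fun x => hg1 x ⟨x, Finset.mem_univ _, by simp⟩⟩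

end Compatible

section NonSplitting

variable {G : Type*} [Group G]

/-- The interval `[A, B]` of normal subgroups does not split. -/
def NormalIntervalNotSplit (A B : Subgroup G) : Prop :=
  ∀ δ ε : Subgroup G, δ.Normal → ε.Normal → A ≤ δ → δ < B → A < ε → ε ≤ B →
    ∃ K : Subgroup G, K.Normal ∧ A ≤ K ∧ K ≤ B ∧ ¬ K ≤ δ ∧ ¬ ε ≤ K

theorem update_mem {k : ℕ} {B : Subgroup G} {x : Fin k → G} (hx : ∀ i, x i ∈ B) (j : Fin k)
    {y : G} (hy : y ∈ B) : ∀ i, Function.update x j y i ∈ B := by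
  intro i
  by_cases h : i = j
  · subst h; simpa using hy
  · simpa [Function.update_of_ne h] using hx i

/-- A compatible function on a non-splitting interval is trivial as soon as it absorbs `1` in
sufficiently many variables. -/
theorem absorbing_trivial [Finite G] {A B : Subgroup G} [hA : A.Normal]
    (hns : NormalIntervalNotSplit A B) {k : ℕ} (n : ℕ) : ∀ v : Subgroup G, v.Normal → A ≤ v →
      v ≤ B → Nat.card v ≤ n → ∀ J : Finset (Fin k), n ≤ J.card →
      ∀ f : (Fin k → G) → G, Compatible f → (∀ x, (∀ i, x i ∈ B) → f x ∈ v) →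
      (∀ j ∈ J, ∀ x, (∀ i, x i ∈ B) → x j = 1 → f x ∈ A) →
      ∀ x, (∀ i, x i ∈ B) → f x ∈ A := by
  induction n with
  | zero =>
    intro v _ _ _ hc
    exact absurd hc (Nat.card_pos (α := v)).not_ge
  | succ n ih =>
    intro v hv hAv hvB hc J hJ
    rcases eq_or_lt_of_le hAv with rfl | hlt
    · intro f _ h _; exact h
    obtain ⟨j, hj⟩ : J.Nonempty := Finset.card_pos.1 (by omega)
    let Inv : Subgroup G → Prop := fun D => D.Normal ∧ A ≤ D ∧ D ≤ B ∧
      ∀ f : (Fin k → G) → G, Compatible f → (∀ x, (∀ i, x i ∈ B) → f x ∈ v) →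
      (∀ j ∈ J, ∀ x, (∀ i, x i ∈ B) → x j = 1 → f x ∈ A) →
      ∀ x, (∀ i, x i ∈ B) → ∀ d ∈ D, (f x)⁻¹ * f (Function.update x j (x j * d)) ∈ A
    have hInvA : Inv A := by
      refine ⟨hA, le_rfl, hAv.trans hvB, fun f hf _ _ x _ d hd => hf A hA _ _ fun i => ?_⟩
      by_cases h : i = j
      · subst h; simpa using hd
      · simp [Function.update_of_ne h]
    obtain ⟨D, ⟨⟨hDn, hAD, hDB, hD⟩, hmax⟩⟩ :=
      exists_maximal_of_wellFoundedGT Inv ⟨A, hInvA⟩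
    have hDB' : D = B := by
      by_contra hne
      obtain ⟨K, hKn, hAK, hKB, hKD, hvK⟩ :=
        hns D v hDn hv hAD (lt_of_le_of_ne hDB hne) hlt hvB
      have hK : ∀ f : (Fin k → G) → G, Compatible f → (∀ x, (∀ i, x i ∈ B) → f x ∈ v) →
          (∀ j ∈ J, ∀ x, (∀ i, x i ∈ B) → x j = 1 → f x ∈ A) →
          ∀ x, (∀ i, x i ∈ B) → ∀ d ∈ K,
            (f x)⁻¹ * f (Function.update x j (x j * d)) ∈ A := by
        intro f hf hfv hfJ x hx d hd
        have hcard : Nat.card ↥(K ⊓ v) ≤ n := by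
          have : Nat.card ↥(K ⊓ v) < Nat.card v := by
            refine lt_of_le_of_ne (Subgroup.card_le_of_le inf_le_right) fun h => ?_
            exact hvK (inf_eq_right.1 (Subgroup.eq_of_le_of_card_ge inf_le_right h.ge))
          omega
        have hfu : ∀ y, Compatible fun z => f (Function.update z j y) := fun y =>
          hf.update j (compatible_const y)
        have := ih (K ⊓ v) (Subgroup.normal_inf_normal K v) (le_inf hAK hAv)
          (inf_le_left.trans hKB) hcard (J.erase j) (by rw [Finset.card_erase_of_mem hj]; omega)
          (fun z => (f (Function.update z j (x j)))⁻¹ * f (Function.update z j (x j * d)))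
          ((hfu _).inv.mul (hfu _)) ?_ ?_ x hx
        · simpa using this
        · intro z hz
          refine ⟨hf K hKn _ _ fun i => ?_, v.mul_mem (v.inv_mem ?_) ?_⟩
          · by_cases h : i = j
            · subst h; simpa using hd
            · simp [Function.update_of_ne h]
          · exact hfv _ (update_mem hz j (hx j))
          · exact hfv _ (update_mem hz j (B.mul_mem (hx j) (hKB hd)))
        · intro i hi z hz hzi
          have hij : i ≠ j := (Finset.mem_erase.1 hi).1
          have hiJ := (Finset.mem_erase.1 hi).2
          refine A.mul_mem (A.inv_mem ?_) ?_
          · exact hfJ i hiJ _ (update_mem hz j (hx j)) (by simpa [Function.update_of_ne hij])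
          · exact hfJ i hiJ _ (update_mem hz j (B.mul_mem (hx j) (hKB hd)))
              (by simpa [Function.update_of_ne hij])
      refine hKD (le_sup_right.trans (hmax (y := D ⊔ K) ⟨Subgroup.sup_normal D K,
        hAD.trans le_sup_left, sup_le hDB hKB, ?_⟩ le_sup_left))
      intro f hf hfv hfJ x hx d hd
      obtain ⟨d₁, h₁, d₂, h₂, rfl⟩ := Subgroup.mem_sup_of_normal_right.1 hd
      have e₁ := hD f hf hfv hfJ x hx d₁ h₁
      have e₂ := hK f hf hfv hfJ _ (update_mem hx j (B.mul_mem (hx j) (hDB h₁))) d₂ h₂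
      simpa [mul_assoc] using A.mul_mem e₁ e₂
    intro f hf hfv hfJ x hx
    have h1 := hfJ j hj (Function.update x j 1) (update_mem hx j B.one_mem) (by simp)
    have h2 := hD f hf hfv hfJ _ (update_mem hx j B.one_mem) (x j) (hDB' ▸ hx j)
    simpa using A.mul_mem h1 h2

/-- On a non-splitting interval, all compatible operations are generated by those of bounded
arity. -/
theorem exists_inClone_of_not_split [Finite G] {A B : Subgroup G} [hA : A.Normal] (hB : B.Normal)
    (hAB : A ≤ B) (hns : NormalIntervalNotSplit A B) {M : ℕ} (hM : 2 ≤ M)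
    (hGM : Nat.card G ≤ M) : ∀ k, 1 ≤ k → ∀ f : (Fin k → G) → G, Compatible f →
      (∀ x, (∀ i, x i ∈ B) → f x ∈ B) →
      ∃ g, InClone (compatibleOps G M) g ∧ ∀ x, (∀ i, x i ∈ B) → (g x)⁻¹ * f x ∈ A := by
  intro k
  induction k with
  | zero => intro h; omega
  | succ k ih =>
    intro _ f hf hfB
    rcases le_or_gt (k + 1) M with hk | hk
    · exact ⟨f, hf.inClone_of_le (by omega) hk, by simp⟩
    have key : ∀ n, n ≤ k + 1 → ∀ f : (Fin (k + 1) → G) → G, Compatible f →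
        (∀ x, (∀ i, x i ∈ B) → f x ∈ B) →
        (∀ j : Fin (k + 1), (j : ℕ) < k + 1 - n → ∀ x, (∀ i, x i ∈ B) → x j = 1 → f x ∈ A) →
        ∃ g, InClone (compatibleOps G M) g ∧ ∀ x, (∀ i, x i ∈ B) → (g x)⁻¹ * f x ∈ A := by
      intro n
      induction n with
      | zero =>
        intro _ f hf hfB hfJ
        refine ⟨_, inClone_const hM (by omega) 1, fun x hx => ?_⟩
        have := absorbing_trivial hns (Nat.card B) B hB hAB le_rfl le_rfl Finset.univ
          (by have := Subgroup.card_le_card_group B; simp; omega) f hf hfB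
          (fun j _ => hfJ j (by omega)) x hx
        simpa using this
      | succ n ihn =>
        intro hn f hf hfB hfJ
        let j : Fin (k + 1) := ⟨k + 1 - (n + 1), by omega⟩
        have hfu : Compatible fun x => f (Function.update x j 1) :=
          hf.update j (compatible_const 1)
        obtain ⟨g, hg, hgf⟩ := ihn (by omega) (fun x => f x * (f (Function.update x j 1))⁻¹)
          (hf.mul hfu.inv)
          (fun x hx => B.mul_mem (hfB x hx) (B.inv_mem (hfB _ (update_mem hx j B.one_mem))))
          (by
            intro i hi x hx hxi
            by_cases hij : i = j
            · have : Function.update x j 1 = x := by rw [← hij, ← hxi]; simp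
              simp [this]
            · have hi' : (i : ℕ) < k + 1 - (n + 1) := by
                have : (i : ℕ) ≠ k + 1 - (n + 1) := fun h => hij (Fin.ext h)
                omega
              exact A.mul_mem (hfJ i hi' x hx hxi) (A.inv_mem (hfJ i hi' _
                (update_mem hx j B.one_mem) (by simpa [Function.update_of_ne hij]))))
        obtain ⟨g', hg', hgf'⟩ := ih (by omega) (fun y => f (j.insertNth 1 y))
          (hf.comp (g := fun i y => (j.insertNth 1 y : Fin (k + 1) → G) i) (by
            intro i
            refine j.succAboveCases ?_ (fun i => ?_) i
            · simpa using compatible_const 1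
            · simpa using compatible_proj i))
          (fun y hy => hfB _ (by
            intro i
            refine j.succAboveCases ?_ (fun i => ?_) i
            · simp
            · simpa using hy i))
        refine ⟨_, hg.mul hM (InClone.comp g' (fun i x => x (j.succAbove i)) hg'
          fun i => .proj _), fun x hx => ?_⟩
        have h1 := hgf x hx
        have h2 := hgf' (fun i => x (j.succAbove i)) fun i => hx _
        have h3 : (j.insertNth 1 (fun i => x (j.succAbove i)) : Fin (k + 1) → G) =
            Function.update x j 1 := by
          ext i
          refine j.succAboveCases ?_ (fun i => ?_) i
          · simp
          · simp
        rw [h3] at h2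
        have h4 := A.mul_mem (hA.conj_mem _ h1 (g' fun i => x (j.succAbove i))⁻¹) h2
        simpa [mul_assoc] using h4
    exact key (k + 1) le_rfl f hf hfB (by intro j hj; omega)

end NonSplitting

section Sufficiency

theorem normalIntervalNotSplit_of_not_intervalSplits {G : Type*} [Group G]
    {A B : {H : Subgroup G // H.Normal}}
    (h : ¬ IntervalSplits A B) : NormalIntervalNotSplit A.1 B.1 := by
  intro δ ε hδ hε h1 h2 h3 h4
  by_contra hn
  push Not at hn
  refine h ⟨⟨δ, hδ⟩, ⟨ε, hε⟩, h1, h2, h3, h4, fun K hK1 hK2 => ?_⟩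
  by_cases hK : K.1 ≤ δ
  exacts [.inl hK, .inr (hn K.1 K.2 hK1 hK2 hK)]

variable {G : Type*} [Group G] [Finite G]

theorem exists_inClone_interval_step {A B : {H : Subgroup G // H.Normal}} (hAB : A ≤ B)
    (hA : Cuts A) (hB : Cuts B)
    (h : (∀ K, A ≤ K → K ≤ B → K = A ∨ K = B) ∨ ¬ IntervalSplits A B)
    {M : ℕ} (hM : 2 ≤ M) (hGM : Nat.card G ≤ M) {k : ℕ} (hk : 1 ≤ k) {r : (Fin k → G) → G}
    (hr : Compatible r) (hrB : ∀ x, r x ∈ B.1) :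
    ∃ g, InClone (compatibleOps G M) g ∧ ∀ x, (g x)⁻¹ * r x ∈ A.1 := by
  have := A.2
  rcases h with h | h
  · refine exists_inClone_of_local (E := A.1) (B := B.1) hAB hM (fun c => ?_) hk hrB fun c => ?_
    · refine (compatible_selector hAB (fun N hN => ?_) c).inClone_of_le one_le_two hM
      rcases hA ⟨N, hN⟩ with h1 | h1
      · exact .inl h1
      rcases hB ⟨N, hN⟩ with h2 | h2
      · rcases h _ h1 h2 with h3 | h3
        exacts [.inl h3.le, .inr h3.ge]
      · exact .inr h2
    · exact ⟨_, inClone_const hM hk (r c), fun x hx => hr A.1 A.2 c x hx⟩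
  · refine exists_inClone_of_local (E := B.1) (B := B.1) hAB hM (fun c => ?_) hk hrB fun c => ?_
    · exact (compatible_selector le_rfl (fun N hN => hB ⟨N, hN⟩) c).inClone_of_le one_le_two hM
    · have hmul : ∀ d : Fin k → G, ∀ i, Compatible fun x : Fin k → G => d i * x i := fun d i =>
        (compatible_const (d i)).mul (compatible_proj i)
      obtain ⟨g, hg, hgr⟩ := exists_inClone_of_not_split B.2 hAB
        (normalIntervalNotSplit_of_not_intervalSplits h) hM hGM k hk
        (fun x => r fun i => c i * x i) (hr.comp (hmul c)) (fun _ _ => hrB _)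
      refine ⟨_, hg.comp g (fun i x => (c i)⁻¹ * x i) fun i =>
        (inClone_const hM hk (c i)⁻¹).mul hM (.proj i), fun x hx => ?_⟩
      simpa using hgr _ hx

theorem compFG_of_intervals {n : ℕ} (N : Fin (n + 1) → {H : Subgroup G // H.Normal})
    (hmono : StrictMono N) (h0 : N 0 = ⊥) (hlast : N (Fin.last n) = ⊤)
    (hcuts : ∀ i, Cuts (N i))
    (h : ∀ i : Fin n,
      (∀ K : {H : Subgroup G // H.Normal}, N i.castSucc ≤ K → K ≤ N i.succ →
          K = N i.castSucc ∨ K = N i.succ)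
        ∨ ¬ IntervalSplits (N i.castSucc) (N i.succ)) : CompFG G := by
  set M := Nat.card G + 2
  refine ⟨compatibleOps G M, finite_compatibleOps M, fun f hf => ⟨hf.1, hf.2.2⟩,
    fun k hk f => ⟨fun hf => ?_, fun hf => hf.compatible fun f hf => hf.2.2⟩⟩
  have key : ∀ i : Fin (n + 1), ∃ g, InClone (compatibleOps G M) g ∧
      ∀ x, (g x)⁻¹ * f x ∈ (N i).1 := by
    intro i
    induction i using Fin.reverseInduction with
    | last => exact ⟨_, inClone_const (by omega) hk 1, fun x => by rw [hlast]; trivial⟩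
    | cast i ih =>
      obtain ⟨g, hg, hgf⟩ := ih
      have hg' : Compatible g := hg.compatible fun f hf => hf.2.2
      obtain ⟨g', hg', hgf'⟩ := exists_inClone_interval_step
        (hmono (Fin.castSucc_lt_succ)).le (hcuts _) (hcuts _) (h i) (M := M)
        (by omega) (by omega) hk (hg'.inv.mul hf) hgf
      exact ⟨_, hg.mul (by omega) hg', fun x => by simpa [mul_assoc] using hgf' x⟩
  obtain ⟨g, hg, hgf⟩ := key 0
  convert hg using 1
  ext x
  have := hgf x
  rw [h0] at this
  exact (inv_mul_eq_one.1 (Subgroup.mem_bot.1 this)).symm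

end Sufficiency

instance NormalSubgroup.instNormal {G : Type*} [Group G] (N : {H : Subgroup G // H.Normal}) :
    N.1.Normal := N.2

section PGroupCovers

variable {p : ℕ} {G : Type*} [Group G] [Finite G]

theorem IsPGroup.exists_mem_center_orderOf_eq (hp : p.Prime) (hG : IsPGroup p G) (H : Subgroup G)
    [H.Normal] (hH : H ≠ ⊥) : ∃ z ∈ H, z ∈ Subgroup.center G ∧ orderOf z = p := by
  have := Fact.mk hp
  have hd : p ∣ Nat.card H :=
    ((hG.to_subgroup H).card_eq_or_dvd).resolve_left fun h => hH (Subgroup.card_eq_one.1 h)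
  have hC : IsPGroup p (ConjAct G) := hG
  obtain ⟨b, hb, hb1⟩ := hC.exists_fixed_point_of_prime_dvd_card_of_fixed_point H hd
    (a := 1) (fun g => smul_one g)
  have hbc : (b : G) ∈ Subgroup.center G := by
    rw [Subgroup.mem_center_iff]
    intro g
    have h := congrArg Subtype.val (hb (ConjAct.toConjAct g))
    rw [ConjAct.Subgroup.val_conj_smul, ConjAct.toConjAct_smul] at h
    exact mul_inv_eq_iff_eq_mul.1 h
  have hpb : p ∣ orderOf (b : G) := by
    obtain ⟨k, hk⟩ := IsPGroup.iff_orderOf.1 hG b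
    rw [hk]
    refine dvd_pow_self p fun h0 => hb1 (Subtype.ext ?_)
    rw [h0, pow_zero, orderOf_eq_one_iff] at hk
    exact hk.symm
  exact ⟨_, H.pow_mem b.2 _, Subgroup.pow_mem _ hbc _,
    orderOf_pow_orderOf_div (orderOf_pos _).ne' hpb⟩

/-- The subgroup generated by a normal subgroup `C` and an element `z`. -/
def adjoin (C : Subgroup G) [C.Normal] (z : G) : Subgroup G :=
  (Subgroup.zpowers (z : G ⧸ C)).comap (QuotientGroup.mk' C)

theorem mem_adjoin {C : Subgroup G} [C.Normal] {z c : G} :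
    c ∈ adjoin C z ↔ ∃ n : ℕ, (z : G ⧸ C) ^ n = c := by
  rw [adjoin, Subgroup.mem_comap, ← mem_powers_iff_mem_zpowers]
  rfl

theorem le_adjoin {C : Subgroup G} [C.Normal] {z : G} : C ≤ adjoin C z := fun c hc =>
  mem_adjoin.2 ⟨0, by rw [pow_zero, eq_comm, QuotientGroup.eq_one_iff]; exact hc⟩

theorem self_mem_adjoin {C : Subgroup G} [C.Normal] {z : G} : z ∈ adjoin C z :=
  mem_adjoin.2 ⟨1, pow_one _⟩

theorem adjoin_le {C D : Subgroup G} [C.Normal] {z : G} (h : C ≤ D) (hz : z ∈ D) :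
    adjoin C z ≤ D := by
  intro c hc
  obtain ⟨n, hn⟩ := mem_adjoin.1 hc
  rw [← QuotientGroup.mk_pow, QuotientGroup.eq] at hn
  exact (D.mul_mem_cancel_left (D.inv_mem (D.pow_mem hz n))).1 (h hn)

theorem normal_adjoin {G : Type*} [Group G] {C : Subgroup G} [C.Normal] {z : G}
    (hz : (z : G ⧸ C) ∈ Subgroup.center (G ⧸ C)) : (adjoin C z).Normal := by
  have : (Subgroup.zpowers (z : G ⧸ C)).Normal := ⟨fun w hw g => by
    have hwc := (Subgroup.zpowers_le.2 hz) hw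
    rwa [Subgroup.mem_center_iff.1 hwc g, mul_inv_cancel_right]⟩
  exact Subgroup.Normal.comap this _

variable {C' C : {H : Subgroup G // H.Normal}}

theorem exists_adjoin_of_covBy (hp : p.Prime) (hG : IsPGroup p G) (h : C' ⋖ C) :
    ∃ z : G, (z : G ⧸ C'.1) ∈ Subgroup.center (G ⧸ C'.1) ∧ (z : G ⧸ C'.1) ^ p = 1 ∧
      C.1 = adjoin C'.1 z := by
  have hQ : IsPGroup p (G ⧸ C'.1) := hG.to_quotient _
  have hC := C.2
  have hn : (C.1.map (QuotientGroup.mk' C'.1)).Normal :=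
    Subgroup.Normal.map hC _ (QuotientGroup.mk'_surjective _)
  have hne : C.1.map (QuotientGroup.mk' C'.1) ≠ ⊥ := by
    rw [Ne, Subgroup.map_eq_bot_iff, QuotientGroup.ker_mk']
    exact h.lt.not_ge
  obtain ⟨w, hw, hwc, hwp⟩ := hQ.exists_mem_center_orderOf_eq hp _ hne
  obtain ⟨z, rfl⟩ := QuotientGroup.mk_surjective w
  refine ⟨z, hwc, hwp ▸ pow_orderOf_eq_one _, ?_⟩
  obtain ⟨y, hy, hyz⟩ := hw
  have hz : z ∈ C.1 := by
    have : y⁻¹ * z ∈ C'.1 := QuotientGroup.eq.1 hyz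
    simpa using C.1.mul_mem hy (h.le this)
  have hle : (⟨adjoin C'.1 z, normal_adjoin hwc⟩ : {H : Subgroup G // H.Normal}) ≤ C :=
    adjoin_le h.le hz
  rcases h.eq_or_eq (c := ⟨adjoin C'.1 z, normal_adjoin hwc⟩) le_adjoin hle with h1 | h1
  · exfalso
    have hz' : z ∈ C'.1 := by
      rw [← h1]; exact self_mem_adjoin
    have h2 : (z : G ⧸ C'.1) = 1 := (QuotientGroup.eq_one_iff z).2 hz'
    rw [h2, orderOf_one] at hwp
    exact hp.one_lt.ne hwp
  · exact (congrArg Subtype.val h1).symm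

theorem mk_mem_center_of_covBy (hp : p.Prime) (hG : IsPGroup p G) (h : C' ⋖ C)
    {c : G} (hc : c ∈ C.1) : (c : G ⧸ C'.1) ∈ Subgroup.center (G ⧸ C'.1) := by
  obtain ⟨z, hz, -, hC⟩ := exists_adjoin_of_covBy hp hG h
  rw [hC] at hc
  obtain ⟨n, hn⟩ := mem_adjoin.1 hc
  exact hn ▸ Subgroup.pow_mem _ hz n

theorem eq_adjoin_of_covBy (hp : p.Prime) (hG : IsPGroup p G) (h : C' ⋖ C)
    {z : G} (hz : z ∈ C.1) (hz' : z ∉ C'.1) : C.1 = adjoin C'.1 z := by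
  have hn := normal_adjoin (mk_mem_center_of_covBy hp hG h hz)
  have hle : (⟨adjoin C'.1 z, hn⟩ : {H : Subgroup G // H.Normal}) ≤ C := adjoin_le h.le hz
  rcases h.eq_or_eq (c := ⟨adjoin C'.1 z, hn⟩) le_adjoin hle with h1 | h1
  · refine absurd ?_ hz'
    rw [← h1]; exact self_mem_adjoin
  · exact (congrArg Subtype.val h1).symm

instance NormalSubgroup.instIsModularLattice {G : Type*} [Group G] :
    IsModularLattice {N : Subgroup G // N.Normal} where
  sup_inf_le_assoc_of_le := by
    intro X Y Z hXZ g hg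
    obtain ⟨hg1, hg2⟩ := hg
    obtain ⟨x, hx, y, hy, rfl⟩ := Subgroup.mem_sup_of_normal_right.1 (show g ∈ X.1 ⊔ Y.1 from hg1)
    exact mul_mem (show x ∈ X.1 ⊔ (Y ⊓ Z).1 from Subgroup.mem_sup_left hx)
      (Subgroup.mem_sup_right (show y ∈ Y.1 ⊓ Z.1 from
        ⟨hy, (Z.1.mul_mem_cancel_left (hXZ hx)).1 hg2⟩))

theorem coversHaveThird_normalSubgroup (hp : p.Prime) (hG : IsPGroup p G) :
    CoversHaveThird {H : Subgroup G // H.Normal} := by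
  intro c x y hcx hcy hxy
  have := Fact.mk hp
  have key : ∀ ⦃x y : {H : Subgroup G // H.Normal}⦄, c ⋖ x → c ⋖ y → x ≠ y →
      ∀ ⦃u v : G⦄, x.1 = adjoin c.1 u → y.1 = adjoin c.1 v → (u : G ⧸ c.1) ^ p = 1 →
        (v : G ⧸ c.1) ^ p = 1 → ∀ g ∈ x.1, g ∈ adjoin c.1 (u * v) → g ∈ c.1 := by
    intro x y hcx hcy hxy u v hux hvy hup hvp g hgx hg
    have hu : u ∈ x.1 := hux ▸ self_mem_adjoin
    have hv : v ∈ y.1 := hvy ▸ self_mem_adjoin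
    obtain ⟨n, hn⟩ := mem_adjoin.1 hg
    have huv : Commute (u : G ⧸ c.1) v :=
      Subgroup.mem_center_iff.1 (mk_mem_center_of_covBy hp hG hcy hv) u
    rw [QuotientGroup.mk_mul, huv.mul_pow] at hn
    have hvn : v ^ n ∈ c.1 := by
      have hvx : v ^ n ∈ x.1 := by
        rw [← QuotientGroup.mk_pow, ← QuotientGroup.mk_pow, ← QuotientGroup.mk_mul,
          eq_comm, QuotientGroup.eq] at hn
        have := x.1.mul_mem hgx (hcx.le hn)
        rw [mul_inv_cancel_left] at this
        exact (x.1.mul_mem_cancel_left (x.1.pow_mem hu n)).1 this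
      by_contra hvc
      exact hxy (Subtype.ext ((eq_adjoin_of_covBy hp hG hcx hvx hvc).trans
        (eq_adjoin_of_covBy hp hG hcy (y.1.pow_mem hv n) hvc).symm))
    have hv1 : (v : G ⧸ c.1) ≠ 1 := by
      intro h
      refine hcy.lt.not_ge ?_
      show y.1 ≤ c.1
      exact hvy ▸ adjoin_le le_rfl ((QuotientGroup.eq_one_iff v).1 h)
    have hpn : p ∣ n := by
      rw [← orderOf_eq_prime hvp hv1]
      refine orderOf_dvd_of_pow_eq_one ?_
      rw [← QuotientGroup.mk_pow]
      exact (QuotientGroup.eq_one_iff _).2 hvn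
    obtain ⟨m, rfl⟩ := hpn
    rw [pow_mul, pow_mul, hup, hvp, one_pow, one_mul] at hn
    exact (QuotientGroup.eq_one_iff g).1 hn.symm
  obtain ⟨u, hu, hup, hux⟩ := exists_adjoin_of_covBy hp hG hcx
  obtain ⟨v, hv, hvp, hvy⟩ := exists_adjoin_of_covBy hp hG hcy
  have hux' : u ∈ x.1 := hux ▸ self_mem_adjoin
  have hvy' : v ∈ y.1 := hvy ▸ self_mem_adjoin
  have hcen : ((u * v : G) : G ⧸ c.1) ∈ Subgroup.center (G ⧸ c.1) := Subgroup.mul_mem _ hu hv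
  have hcomm : adjoin c.1 (u * v) = adjoin c.1 (v * u) := by
    rw [adjoin, adjoin, QuotientGroup.mk_mul, QuotientGroup.mk_mul, Subgroup.mem_center_iff.1 hv]
  let d : {H : Subgroup G // H.Normal} := ⟨adjoin c.1 (u * v), normal_adjoin hcen⟩
  have hcd : c ≤ d := le_adjoin (C := c.1)
  have hud : u * v ∈ d.1 := self_mem_adjoin (C := c.1)
  have hd : d ≤ x ⊔ y := adjoin_le (D := (x ⊔ y).1) (hcx.le.trans le_sup_left)
    (Subgroup.mul_mem _ (le_sup_left (a := x) hux') (le_sup_right (a := x) hvy'))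
  have hyd : y ≤ x ⊔ d := by
    show y.1 ≤ (x ⊔ d).1
    rw [hvy]
    exact adjoin_le (hcx.le.trans le_sup_left) ((Subgroup.mul_mem_cancel_left _
      (le_sup_left (a := x) hux')).1 (le_sup_right (a := x) hud))
  have hxd : x ≤ y ⊔ d := by
    show x.1 ≤ (y ⊔ d).1
    rw [hux]
    exact adjoin_le (hcy.le.trans le_sup_left) ((Subgroup.mul_mem_cancel_right _
      (le_sup_left (a := y) hvy')).1 (le_sup_right (a := y) hud))
  exact ⟨d, hd, le_antisymm (fun g hg => key hcx hcy hxy hux hvy hup hvp g hg.1 hg.2)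
      (le_inf hcx.le hcd),
    le_antisymm (fun g hg => key hcy hcx hxy.symm hvy hux hvp hup g hg.1 (hcomm ▸ hg.2))
      (le_inf hcy.le hcd), le_antisymm (sup_le hxd le_sup_right) (sup_le hyd le_sup_right)⟩

end PGroupCovers

section Centrality

variable {G : Type*} [Group G]

/-- Modulo `C'`, the increment of a compatible function along a tuple over `C` depends only on the
coset of the base point modulo `D`. -/
def Centralizes (D C' C : {H : Subgroup G // H.Normal}) : Prop :=
  ∀ (k : ℕ) (f : (Fin k → G) → G), Compatible f → ∀ x y c : Fin k → G,
    (∀ i, (x i : G ⧸ D.1) = y i) → (∀ i, c i ∈ C.1) →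
      (((f x)⁻¹ * f (x * c) : G) : G ⧸ C'.1) = ((f y)⁻¹ * f (y * c) : G)

variable {D D₁ D₂ C C' : {H : Subgroup G // H.Normal}}

theorem Compatible.increment_mem {k : ℕ} {f : (Fin k → G) → G} (hf : Compatible f)
    (x : Fin k → G) {c : Fin k → G} (hc : ∀ i, c i ∈ C.1) : (f x)⁻¹ * f (x * c) ∈ C.1 :=
  hf C.1 C.2 _ _ fun i => by simpa using hc i

theorem centralizes_of_inf_le (h : C ⊓ D ≤ C') : Centralizes D C' C := by
  intro k f hf x y c hxy hc
  rw [QuotientGroup.eq]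
  refine h ⟨C.1.mul_mem (C.1.inv_mem (hf.increment_mem x hc)) (hf.increment_mem y hc), ?_⟩
  refine (QuotientGroup.eq (s := D.1)).1 ?_
  have h1 := hf.mk_eq D.1 hxy
  have h2 := hf.mk_eq D.1 (a := x * c) (b := y * c) fun i => by
    simp only [Pi.mul_apply, QuotientGroup.mk_mul, hxy]
  rw [QuotientGroup.mk_mul, QuotientGroup.mk_mul, QuotientGroup.mk_inv, QuotientGroup.mk_inv,
    h1, h2]

theorem Centralizes.sup (h₁ : Centralizes D₁ C' C) (h₂ : Centralizes D₂ C' C) :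
    Centralizes (D₁ ⊔ D₂) C' C := by
  intro k f hf x y c hxy hc
  have hs : ∀ i, ∃ a ∈ D₁.1, ∃ b ∈ D₂.1, a * b = (x i)⁻¹ * y i := fun i =>
    Subgroup.mem_sup_of_normal_right.1 (QuotientGroup.eq.1 (hxy i))
  choose a ha b hb hab using hs
  refine (h₁ k f hf x (x * a) c (fun i => ?_) hc).trans
    (h₂ k f hf (x * a) y c (fun i => ?_) hc)
  · rw [QuotientGroup.eq]; simpa using ha i
  · rw [QuotientGroup.eq, Pi.mul_apply, mul_inv_rev, mul_assoc, ← hab, inv_mul_cancel_left]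
    exact hb i

theorem centralizes_iff_of_transpose {E E' : {H : Subgroup G // H.Normal}} (h1 : C ⊓ E' = C')
    (h2 : C ⊔ E' = E) : Centralizes D C' C ↔ Centralizes D E' E := by
  constructor
  · intro h k f hf x y e hxy he
    have hs : ∀ i, ∃ a ∈ C.1, ∃ b ∈ E'.1, a * b = e i := fun i =>
      Subgroup.mem_sup_of_normal_right.1 (show e i ∈ C.1 ⊔ E'.1 from (h2 ▸ he i : e i ∈ (C ⊔ E').1))
    choose c hc b hb hcb using hs
    have hmod : ∀ z : Fin k → G, (((f z)⁻¹ * f (z * e) : G) : G ⧸ E'.1)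
        = ((f z)⁻¹ * f (z * c) : G) := by
      intro z
      rw [QuotientGroup.mk_mul, QuotientGroup.mk_mul]
      congr 1
      refine hf.mk_eq E'.1 fun i => ?_
      rw [eq_comm, QuotientGroup.eq, Pi.mul_apply, Pi.mul_apply, ← hcb]
      simpa [mul_assoc] using hb i
    rw [hmod, hmod]
    have := h k f hf x y c hxy hc
    rw [QuotientGroup.eq] at this ⊢
    exact (h1 ▸ inf_le_right : C' ≤ E') this
  · intro h k f hf x y c hxy hc
    have := h k f hf x y c hxy fun i => (h2 ▸ le_sup_left : C ≤ E) (hc i)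
    rw [QuotientGroup.eq] at this ⊢
    rw [← h1]
    exact ⟨C.1.mul_mem (C.1.inv_mem (hf.increment_mem x hc)) (hf.increment_mem y hc), this⟩

theorem centralizes_of_covBy_of_noInnerCut [Finite G]
    (h3 : CoversHaveThird {H : Subgroup G // H.Normal}) {A B M : {H : Subgroup G // H.Normal}}
    (hcut : NoInnerCut A B) (hAM : A < M) (hMB : M < B) (hAC : A ≤ C') (hcov : C' ⋖ C)
    (hCB : C ≤ B) : Centralizes B C' C := by
  have hconst : ∀ D, ∀ ⦃U' U : {H : Subgroup G // H.Normal}⦄, A ≤ U' → U' ⋖ U → U ≤ B →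
      Centralizes D U' U → ∀ ⦃V' V⦄, A ≤ V' → V' ⋖ V → V ≤ B → Centralizes D V' V :=
    fun D U' U h1 h2 h4 h V' V h5 h6 h7 =>
      covBy_predicate_constant h3 hcut (Centralizes D)
        (fun _ _ _ _ _ _ hi hs => centralizes_iff_of_transpose hi hs) h1 h2 h4 h5 h6 h7 h
  obtain ⟨Z, ⟨⟨hAZ, hZB, hZ⟩, hmax⟩⟩ := exists_maximal_of_wellFoundedGT
    (fun Z => A ≤ Z ∧ Z ≤ B ∧ ∀ V' V, A ≤ V' → V' ⋖ V → V ≤ B → Centralizes Z V' V)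
    ⟨A, le_rfl, hAM.le.trans hMB.le, fun V' V h1 _ _ =>
      centralizes_of_inf_le (inf_le_right.trans h1)⟩
  have hext : ∀ W, A ≤ W → W ≤ B → (∃ U' U, A ≤ U' ∧ U' ⋖ U ∧ U ≤ B ∧ Centralizes W U' U) →
      W ≤ Z := by
    rintro W hAW hWB ⟨U', U, h1, h2, h4, h⟩
    exact le_sup_right.trans (hmax ⟨hAZ.trans le_sup_left, sup_le hZB hWB, fun V' V h5 h6 h7 =>
      (hZ V' V h5 h6 h7).sup (hconst W h1 h2 h4 h h5 h6 h7)⟩ (le_sup_left (b := W)))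
  suffices Z = B from this ▸ hZ _ _ hAC hcov hCB
  by_contra hne
  rcases eq_or_lt_of_le hAZ with h | h
  · obtain ⟨K, hK, hKM⟩ := exists_covBy_le_of_lt hAM
    obtain ⟨W, hAW, hWB, h1, h2⟩ := hcut K hK.lt (hKM.trans_lt hMB)
    have hWK : K ⊓ W ≤ A := by
      rcases hK.eq_or_eq (le_inf hK.le hAW) inf_le_left with h | h
      · exact h.le
      · exact absurd (inf_eq_left.1 h) h2
    have := hext W hAW hWB ⟨A, K, le_rfl, hK, hKM.trans hMB.le, centralizes_of_inf_le hWK⟩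
    exact h1 ((this.trans h.ge).trans hK.le)
  · obtain ⟨K, hAK, hKB, h1, h2⟩ := hcut Z h (lt_of_le_of_ne hZB hne)
    obtain ⟨x, y, hxK, hyZ, hAx, hxZ, hcx, hcy, hxy⟩ :=
      exists_covBy_inf_of_incomparable hAK hAZ h1 h2
    obtain ⟨d, hd, hxd, -, hj⟩ := h3 hcx hcy hxy
    have hdZ := hext d (hAx.trans (hxd ▸ inf_le_right))
      (hd.trans (sup_le (hxK.trans hKB) (hyZ.trans hZB)))
      ⟨_, _, hAx, hcx, hxK.trans hKB, centralizes_of_inf_le hxd.le⟩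
    exact hxZ (le_sup_left.trans (hj.le.trans (sup_le hyZ hdZ)))

end Centrality

section Degree

variable {R ι : Type*} [CommRing R]

/-- The span of the functions on the cube that depend on at most `d` coordinates. -/
def degreeLE (R ι : Type*) [CommRing R] (d : ℕ) : Submodule R ((ι → Bool) → R) :=
  Submodule.span R {f | ∃ S : Finset ι, S.card ≤ d ∧ DependsOn f S}

theorem degreeLE_mono {d e : ℕ} (h : d ≤ e) : degreeLE R ι d ≤ degreeLE R ι e :=
  Submodule.span_mono fun _ ⟨S, hS, hf⟩ => ⟨S, hS.trans h, hf⟩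

theorem const_mem_degreeLE (c : R) (d : ℕ) : (fun _ => c) ∈ degreeLE R ι d :=
  Submodule.subset_span ⟨∅, by simp, fun _ _ _ => rfl⟩

theorem comp_eval_mem_degreeLE (φ : Bool → R) (j : ι) : (fun s => φ (s j)) ∈ degreeLE R ι 1 :=
  Submodule.subset_span ⟨{j}, by simp, fun s t h => congrArg φ (h j (by simp))⟩

theorem mul_mem_degreeLE {d e : ℕ} {f g : (ι → Bool) → R} (hf : f ∈ degreeLE R ι d)
    (hg : g ∈ degreeLE R ι e) : f * g ∈ degreeLE R ι (d + e) := by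
  classical
  have h := Submodule.mul_mem_mul hf hg
  rw [degreeLE, degreeLE, Submodule.span_mul_span] at h
  refine Submodule.span_mono ?_ h
  rintro _ ⟨f, ⟨S, hS, hf⟩, g, ⟨T, hT, hg⟩, rfl⟩
  refine ⟨S ∪ T, (Finset.card_union_le S T).trans (add_le_add hS hT), fun s t hst => ?_⟩
  exact congrArg₂ (· * ·) (hf fun i hi => hst i (by simp_all)) (hg fun i hi => hst i (by simp_all))

theorem prod_mem_degreeLE {d : ℕ} {α : Type*} (s : Finset α) {f : α → (ι → Bool) → R}
    (hf : ∀ a ∈ s, f a ∈ degreeLE R ι d) : ∏ a ∈ s, f a ∈ degreeLE R ι (s.card * d) := by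
  classical
  induction s using Finset.induction_on with
  | empty => exact const_mem_degreeLE 1 _
  | insert a s ha ih =>
    rw [Finset.prod_insert ha, Finset.card_insert_of_notMem ha, add_mul, one_mul, add_comm]
    exact mul_mem_degreeLE (hf a (Finset.mem_insert_self _ _))
      (ih fun b hb => hf b (Finset.mem_insert_of_mem hb))

theorem pow_mem_degreeLE {d : ℕ} {f : (ι → Bool) → R} (hf : f ∈ degreeLE R ι d) (n : ℕ) :
    f ^ n ∈ degreeLE R ι (n * d) := by
  have := prod_mem_degreeLE (Finset.range n) (f := fun _ => f) fun _ _ => hf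
  simpa using this

theorem comp_pi_mem_degreeLE {Q : Type*} [Finite Q] {d m : ℕ} {ρ : Fin m → (ι → Bool) → Q}
    (hρ : ∀ j, ∀ φ : Q → R, (fun s => φ (ρ j s)) ∈ degreeLE R ι d) (H : (Fin m → Q) → R) :
    (fun s => H fun j => ρ j s) ∈ degreeLE R ι (m * d) := by
  classical
  have := Fintype.ofFinite Q
  have h : (fun s => H fun j => ρ j s)
      = ∑ q : Fin m → Q, H q • ∏ j, fun s => if ρ j s = q j then (1 : R) else 0 := by
    ext s
    simp only [Finset.sum_apply, Pi.smul_apply, Finset.prod_apply, smul_eq_mul,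
      Finset.prod_ite_zero, Finset.prod_const_one, Finset.mem_univ, true_imp_iff]
    rw [Finset.sum_eq_single fun j => ρ j s]
    · simp
    · intro q _ hq
      rw [if_neg fun h => hq (funext fun j => (h j).symm), mul_zero]
    · simp
  rw [h]
  refine Submodule.sum_mem _ fun q _ => Submodule.smul_mem _ _ ?_
  simpa using prod_mem_degreeLE (Finset.univ : Finset (Fin m))
    fun j _ => hρ j fun x => if x = q j then 1 else 0

theorem comp_prod_mem_degreeLE {P Q : Type*} [Finite P] [Finite Q] {d e : ℕ}
    {u : (ι → Bool) → P} {v : (ι → Bool) → Q}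
    (hu : ∀ φ : P → R, (fun s => φ (u s)) ∈ degreeLE R ι d)
    (hv : ∀ φ : Q → R, (fun s => φ (v s)) ∈ degreeLE R ι e) (H : P → Q → R) :
    (fun s => H (u s) (v s)) ∈ degreeLE R ι (d + e) := by
  classical
  have := Fintype.ofFinite P
  have h : (fun s => H (u s) (v s))
      = ∑ a : P, (fun s => if u s = a then (1 : R) else 0) * fun s => H a (v s) := by
    ext s
    simp [Finset.sum_apply]
  rw [h]
  exact Submodule.sum_mem _ fun a _ =>
    mul_mem_degreeLE (hu fun x => if x = a then 1 else 0) (hv (H a))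

theorem comp_zmod_mem_degreeLE {p : ℕ} [Fact p.Prime] {d : ℕ} {f : (ι → Bool) → ZMod p}
    (hf : f ∈ degreeLE (ZMod p) ι d) (φ : ZMod p → ZMod p) :
    (fun s => φ (f s)) ∈ degreeLE (ZMod p) ι ((p - 1) * d) := by
  classical
  have h : (fun s => φ (f s)) = ∑ a : ZMod p, φ a • (1 - (f - fun _ => a) ^ (p - 1)) := by
    ext s
    simp only [Finset.sum_apply, Pi.smul_apply, smul_eq_mul, Pi.sub_apply, Pi.pow_apply,
      Pi.one_apply]
    rw [Finset.sum_eq_single (f s)]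
    · rw [sub_self, zero_pow (Nat.sub_ne_zero_of_lt (Fact.out : p.Prime).one_lt), sub_zero, mul_one]
    · intro a _ ha
      rw [ZMod.pow_card_sub_one_eq_one (sub_ne_zero.2 ha.symm), sub_self, mul_zero]
    · simp
  rw [h]
  exact Submodule.sum_mem _ fun a _ => Submodule.smul_mem _ _ (Submodule.sub_mem _
    (const_mem_degreeLE 1 _) (pow_mem_degreeLE (Submodule.sub_mem _ hf (const_mem_degreeLE a _)) _))

theorem conjunction_notMem_degreeLE [Nontrivial R] [Fintype ι] {d : ℕ} (h : d < Fintype.card ι) :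
    (fun s : ι → Bool => if ∀ j, s j = true then (1 : R) else 0) ∉ degreeLE R ι d := by
  classical
  let sign : (ι → Bool) → R := fun s => ∏ j, if s j = true then 1 else -1
  let L : ((ι → Bool) → R) →ₗ[R] R := Fintype.linearCombination R sign
  have hL : ∀ f, L f = ∑ s, f s * sign s := fun f => by
    simp [L, Fintype.linearCombination_apply]
  have hker : degreeLE R ι d ≤ LinearMap.ker L := by
    refine Submodule.span_le.2 ?_
    rintro f ⟨S, hS, hf⟩
    obtain ⟨j, hj⟩ : ∃ j, j ∉ S := by
      by_contra! hn
      rw [Finset.eq_univ_of_forall hn, Finset.card_univ] at hS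
      exact hS.not_gt h
    rw [SetLike.mem_coe, LinearMap.mem_ker, hL]
    refine Finset.sum_involution (fun s _ => Function.update s j (!s j)) ?_ ?_ ?_ ?_
    · intro s _
      have h1 : f (Function.update s j (!s j)) = f s := hf fun i hi => by
        rw [Function.update_of_ne]; rintro rfl; exact hj hi
      have h2 : sign (Function.update s j (!s j)) = - sign s := by
        simp only [sign]
        rw [← Finset.mul_prod_erase _ _ (Finset.mem_univ j),
          ← Finset.mul_prod_erase _ (fun i => if s i = true then (1 : R) else -1)
            (Finset.mem_univ j), ← neg_mul]
        congr 1
        · cases s j <;> simp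
        · refine Finset.prod_congr rfl fun i hi => ?_
          rw [Function.update_of_ne (Finset.ne_of_mem_erase hi)]
      rw [h1, h2]; ring
    · intro s _ _ hs
      have := congrFun hs j
      simp at this
    · simp
    · simp
  intro hmem
  have := hker hmem
  rw [LinearMap.mem_ker, hL, Finset.sum_eq_single fun _ => true] at this
  · simp [sign] at this
  · intro s _ hs
    rw [if_neg fun hn => hs (funext hn), zero_mul]
  · simp

end Degree

section Coordinates

variable {p : ℕ} {G : Type*} [Group G] {B C' C : {H : Subgroup G // H.Normal}}

/-- Coordinates for a quotient `C / C'` of order `p`: the function `π` restricts to a homomorphism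
from `C` to `ZMod p` that has kernel `C'` and sends `z` to `1`, and `ζ` extends it to `G` such that
right translation by `c ∈ C` adds `π c`. -/
structure IsCoordinate (p : ℕ) (C' C : {H : Subgroup G // H.Normal}) (z : G)
    (π ζ : G → ZMod p) : Prop where
  mem : z ∈ C.1
  exists_pow : ∀ c ∈ C.1, ∃ n : ℕ, (z : G ⧸ C'.1) ^ n = c
  apply_eq : ∀ (c : G) (n : ℕ), (z : G ⧸ C'.1) ^ n = c → π c = n
  mem_of_eq_zero : ∀ c ∈ C.1, π c = 0 → c ∈ C'.1
  apply_mul : ∀ x, ∀ c ∈ C.1, ζ (x * c) = ζ x + π c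

theorem exists_isCoordinate [Finite G] (hp : p.Prime) (hG : IsPGroup p G) (h : C' ⋖ C) :
    ∃ z π ζ, IsCoordinate p C' C z π ζ := by
  classical
  have := Fact.mk hp
  obtain ⟨z, -, hzp, hzC⟩ := exists_adjoin_of_covBy hp hG h
  have hz1 : (z : G ⧸ C'.1) ≠ 1 := by
    intro h1
    refine h.lt.not_ge ?_
    show C.1 ≤ C'.1
    exact hzC ▸ adjoin_le le_rfl ((QuotientGroup.eq_one_iff z).1 h1)
  have hpow : ∀ c ∈ C.1, ∃ n : ℕ, (z : G ⧸ C'.1) ^ n = c := fun c hc => mem_adjoin.1 (hzC ▸ hc)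
  let π : G → ZMod p := fun c =>
    if hc : ∃ n : ℕ, (z : G ⧸ C'.1) ^ n = c then (hc.choose : ZMod p) else 0
  have hπ : ∀ (c : G) (n : ℕ), (z : G ⧸ C'.1) ^ n = c → π c = n := by
    intro c n hn
    have hc : ∃ n : ℕ, (z : G ⧸ C'.1) ^ n = c := ⟨n, hn⟩
    simp only [π, dif_pos hc]
    rw [ZMod.natCast_eq_natCast_iff, ← orderOf_eq_prime hzp hz1, ← pow_eq_pow_iff_modEq]
    exact hc.choose_spec.trans hn.symm
  have hadd : ∀ c ∈ C.1, ∀ d ∈ C.1, π (c * d) = π c + π d := by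
    intro c hc d hd
    obtain ⟨m, hm⟩ := hpow c hc
    obtain ⟨n, hn⟩ := hpow d hd
    rw [hπ c m hm, hπ d n hn, hπ (c * d) (m + n) (by rw [pow_add, hm, hn]; rfl), Nat.cast_add]
  let r : G → G := fun x => Quotient.out (x : G ⧸ C.1)
  refine ⟨z, π, fun x => π ((r x)⁻¹ * x), hzC ▸ self_mem_adjoin, hpow, hπ, ?_, ?_⟩
  · intro c hc h0
    obtain ⟨n, hn⟩ := hpow c hc
    rw [hπ c n hn, ZMod.natCast_eq_zero_iff] at h0
    obtain ⟨m, rfl⟩ := h0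
    rw [pow_mul, hzp, one_pow] at hn
    exact (QuotientGroup.eq_one_iff c).1 hn.symm
  · intro x c hc
    have hr : r (x * c) = r x := by
      simp only [r]
      congr 1
      rw [eq_comm, QuotientGroup.eq]
      simpa using hc
    simp only [hr, ← mul_assoc]
    exact hadd _ (QuotientGroup.eq.1 (QuotientGroup.out_eq' (x : G ⧸ C.1))) c hc

variable {z : G} {π ζ : G → ZMod p}

theorem IsCoordinate.map_congr (h : IsCoordinate p C' C z π ζ) {c d : G} (hc : c ∈ C.1)
    (hcd : (c : G ⧸ C'.1) = d) : π c = π d := by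
  obtain ⟨n, hn⟩ := h.exists_pow c hc
  rw [h.apply_eq c n hn, h.apply_eq d n (hn.trans hcd)]

theorem IsCoordinate.map_mul (h : IsCoordinate p C' C z π ζ) {c d : G} (hc : c ∈ C.1)
    (hd : d ∈ C.1) : π (c * d) = π c + π d := by
  obtain ⟨m, hm⟩ := h.exists_pow c hc
  obtain ⟨n, hn⟩ := h.exists_pow d hd
  rw [h.apply_eq c m hm, h.apply_eq d n hn,
    h.apply_eq (c * d) (m + n) (by rw [pow_add, hm, hn]; rfl), Nat.cast_add]

/-- If `B` centralizes `C / C'`, the increments in coordinates of a compatible function are linear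
on each coset of a power of `B`. -/
theorem IsCoordinate.increment_eq_sum (h : IsCoordinate p C' C z π ζ) (hCB : C ≤ B)
    (hcen : Centralizes B C' C) {m : ℕ} {f : (Fin m → G) → G} (hf : Compatible f)
    (y : Fin m → G) : ∃ l : Fin m → ZMod p, ∀ x c : Fin m → G, (∀ i, (x i : G ⧸ B.1) = y i) →
      (∀ i, c i ∈ C.1) → π ((f x)⁻¹ * f (x * c)) = ∑ j, l j * π (c j) := by
  let Λ : (Fin m → G) → ZMod p := fun c => π ((f y)⁻¹ * f (y * c))
  have hbase : ∀ x c : Fin m → G, (∀ i, (x i : G ⧸ B.1) = y i) →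
      (∀ i, c i ∈ C.1) → π ((f x)⁻¹ * f (x * c)) = Λ c := fun x c hx hc =>
    h.map_congr (hf.increment_mem x hc) (hcen m f hf x y c hx hc)
  have hmul : ∀ c d : Fin m → G, (∀ i, c i ∈ C.1) → (∀ i, d i ∈ C.1) →
      Λ (c * d) = Λ c + Λ d := by
    intro c d hc hd
    rw [← hbase (y * c) d (fun i => by
      rw [eq_comm, QuotientGroup.eq]; simpa using hCB (hc i)) hd]
    simp only [Λ]
    rw [← h.map_mul (hf.increment_mem y hc) (hf.increment_mem _ hd)]
    congr 1
    simp [mul_assoc]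
  have hzero : ∀ c : Fin m → G, (∀ i, c i ∈ C'.1) → Λ c = 0 := by
    intro c hc
    have := h.apply_eq ((f y)⁻¹ * f (y * c)) 0 (by
      rw [pow_zero, eq_comm, QuotientGroup.eq_one_iff]
      exact hf.increment_mem y hc)
    simpa using this
  have hzC : ∀ n : Fin m → ℕ, ∀ i, z ^ n i ∈ C.1 := fun n i => C.1.pow_mem h.mem _
  let Ψ : (Fin m → ℕ) →+ ZMod p :=
    { toFun := fun n => Λ fun j => z ^ n j
      map_zero' := hzero _ fun i => by simp
      map_add' := fun n n' => by
        rw [← hmul _ _ (hzC n) (hzC n')]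
        congr 1
        ext j
        simp [pow_add] }
  refine ⟨fun j => Ψ (Pi.single j 1), fun x c hx hc => ?_⟩
  rw [hbase x c hx hc]
  choose n hn using fun j => h.exists_pow (c j) (hc j)
  have hc' : ∀ j, (z ^ n j)⁻¹ * c j ∈ C'.1 := fun j => by
    rw [← QuotientGroup.eq]; exact hn j
  have h1 : Λ c = Ψ n := by
    have hsplit : c = (fun j => z ^ n j) * fun j => (z ^ n j)⁻¹ * c j := by
      ext j; simp
    conv_lhs => rw [hsplit]
    rw [hmul _ _ (hzC n) fun i => C.1.mul_mem (C.1.inv_mem (hzC n i)) (hc i), hzero _ hc', add_zero]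
    rfl
  have h2 : n = ∑ j, n j • Pi.single j 1 := by
    conv_lhs => rw [← Finset.univ_sum_single n]
    refine Finset.sum_congr rfl fun j _ => ?_
    rw [← Pi.single_smul', smul_eq_mul, mul_one]
  rw [h1, h2, map_sum]
  refine Finset.sum_congr rfl fun j _ => ?_
  rw [map_nsmul, nsmul_eq_mul, mul_comm, h.apply_eq _ _ (hn j)]

theorem IsCoordinate.exists_eq_sum_add (h : IsCoordinate p C' C z π ζ) (hCB : C ≤ B)
    (hcen : Centralizes B C' C) {m : ℕ} {f : (Fin m → G) → G} (hf : Compatible f)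
    (y : Fin m → G) : ∃ (l : Fin m → ZMod p) (H : (Fin m → G ⧸ C.1) → ZMod p),
      ∀ x : Fin m → G, (∀ i, (x i : G ⧸ B.1) = y i) →
        ζ (f x) = ∑ j, l j * ζ (x j) + H fun j => (x j : G ⧸ C.1) := by
  classical
  obtain ⟨l, hl⟩ := h.increment_eq_sum hCB hcen hf y
  let T : (Fin m → G ⧸ C.1) → (Fin m → G) → Prop := fun q x =>
    (∀ i, (x i : G ⧸ B.1) = y i) ∧ ∀ i, (x i : G ⧸ C.1) = q i
  let H : (Fin m → G ⧸ C.1) → ZMod p := fun q =>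
    if hq : ∃ x, T q x then ζ (f hq.choose) - ∑ j, l j * ζ (hq.choose j) else 0
  refine ⟨l, H, fun x hx => ?_⟩
  have hq : ∃ x', T (fun j => (x j : G ⧸ C.1)) x' := ⟨x, hx, fun _ => rfl⟩
  obtain ⟨h1, h2⟩ := hq.choose_spec
  simp only [H, dif_pos hq]
  set x' := hq.choose
  have hc : ∀ i, (x'⁻¹ * x) i ∈ C.1 := fun i => QuotientGroup.eq.1 (h2 i)
  have hxx : x = x' * (x'⁻¹ * x) := by simp
  have h3 : ζ (f x) = ζ (f x') + ∑ j, l j * π ((x'⁻¹ * x) j) := by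
    rw [← hl x' _ h1 hc, ← hxx, ← h.apply_mul _ _ (by
      have := hf.increment_mem x' hc
      rwa [← hxx] at this), mul_inv_cancel_left]
  have h4 : ∀ j, ζ (x j) = ζ (x' j) + π ((x'⁻¹ * x) j) := fun j => by
    rw [← h.apply_mul _ _ (hc j), Pi.mul_apply, Pi.inv_apply, mul_inv_cancel_left]
  simp only [h3, h4, mul_add, Finset.sum_add_distrib]
  ring

theorem IsCoordinate.mk_eq (h : IsCoordinate p C' C z π ζ) {x y : G} (hxy : (x : G ⧸ C.1) = y)
    (hζ : ζ x = ζ y) : (x : G ⧸ C'.1) = y := by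
  rw [QuotientGroup.eq] at hxy ⊢
  refine h.mem_of_eq_zero _ hxy ?_
  have := h.apply_mul x _ hxy
  rw [mul_inv_cancel_left, hζ] at this
  simpa using this.symm

end Coordinates

section Necessity

/-- The functions obtained from the family `γ` by applying operations from `F` pointwise. -/
inductive Reachable {A X ι : Type*} (F : Set (FinOp A)) (γ : ι → X → A) : (X → A) → Prop
  | base (j : ι) : Reachable F γ (γ j)
  | app {n : ℕ} (f : (Fin n → A) → A) (τ : Fin n → X → A) : (⟨n, f⟩ : FinOp A) ∈ F →
      (∀ i, Reachable F γ (τ i)) → Reachable F γ fun s => f fun i => τ i s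

theorem InClone.reachable {A X ι : Type*} {F : Set (FinOp A)} {γ : ι → X → A} {n : ℕ}
    {f : (Fin n → A) → A} (hf : InClone F f) {τ : Fin n → X → A}
    (hτ : ∀ i, Reachable F γ (τ i)) : Reachable F γ fun s => f fun i => τ i s := by
  induction hf with
  | proj i => exact hτ i
  | base f hf => exact .app f τ hf hτ
  | comp f g _ _ ihf ihg => exact ihf fun i => ihg i hτ

variable {p : ℕ} {G : Type*} [Group G] {F : Set (FinOp G)} {B C' C : {H : Subgroup G // H.Normal}}

/-- The generators of the cube: the `j`-th one takes the value `v` if the `j`-th coordinate is set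
and `1` otherwise. -/
def cubeVertex (v : G) {ι : Type*} (j : ι) (s : ι → Bool) : G := if s j = true then v else 1

/-- The images modulo `C` of all functions reachable on cubes have bounded degree. -/
def BoundedDegree (p : ℕ) (F : Set (FinOp G)) (v : G) (C : {H : Subgroup G // H.Normal}) : Prop :=
  ∃ d, ∀ (k : ℕ) (τ : (Fin k → Bool) → G), Reachable F (cubeVertex v) τ →
    ∀ φ : G ⧸ C.1 → ZMod p, (fun s => φ (τ s)) ∈ degreeLE (ZMod p) (Fin k) d

theorem Reachable.mk_eq_one (hF : ∀ f ∈ F, Compatible f.2) {v : G} (hv : v ∈ B.1) {k : ℕ}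
    {τ : (Fin k → Bool) → G} (hτ : Reachable F (cubeVertex v) τ) (s t : Fin k → Bool) :
    (τ s : G ⧸ B.1) = τ t := by
  have hv1 : (v : G ⧸ B.1) = 1 := (QuotientGroup.eq_one_iff v).2 hv
  induction hτ with
  | base j => unfold cubeVertex; split_ifs <;> simp [hv1]
  | app f τ hf _ ih => exact (hF _ hf).mk_eq B.1 ih

theorem BoundedDegree.of_mem (hF : ∀ f ∈ F, Compatible f.2) {v : G} (hv : v ∈ B.1) :
    BoundedDegree p F v B := by
  refine ⟨0, fun k τ hτ φ => ?_⟩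
  have : (fun s => φ (τ s)) = fun _ => φ (τ fun _ => true) :=
    funext fun s => congrArg φ (hτ.mk_eq_one hF hv s _)
  rw [this]
  exact const_mem_degreeLE _ _

theorem BoundedDegree.of_centralizes [Finite G] (hp : p.Prime) (hG : IsPGroup p G)
    (hFfin : F.Finite) (hF : ∀ f ∈ F, Compatible f.2) {v : G} (hv : v ∈ B.1) (hcov : C' ⋖ C)
    (hCB : C ≤ B) (hcen : Centralizes B C' C) (h : BoundedDegree p F v C) :
    BoundedDegree p F v C' := by
  have := Fact.mk hp
  obtain ⟨d, hd⟩ := h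
  obtain ⟨z, π, ζ, hζ⟩ := exists_isCoordinate hp hG hcov
  obtain ⟨m₀, hm₀⟩ : ∃ m₀, ∀ f ∈ F, f.1 ≤ m₀ := by
    obtain ⟨m₀, hm₀⟩ := (hFfin.image Sigma.fst).bddAbove
    exact ⟨m₀, fun f hf => hm₀ ⟨f, hf, rfl⟩⟩
  set d' := max 1 (m₀ * d)
  have hdeg : ∀ (k : ℕ) (τ : (Fin k → Bool) → G), Reachable F (cubeVertex v) τ →
      (fun s => ζ (τ s)) ∈ degreeLE (ZMod p) (Fin k) d' := by
    intro k τ hτ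
    induction hτ with
    | base j =>
      exact degreeLE_mono (le_max_left _ _)
        (comp_eval_mem_degreeLE (fun b => ζ (if b = true then v else 1)) j)
    | @app n f τ hf hτ ih =>
      obtain ⟨l, H, hlH⟩ := hζ.exists_eq_sum_add hCB hcen (hF _ hf) fun i => τ i fun _ => true
      have hrw : (fun s => ζ (f fun i => τ i s))
          = (∑ j, l j • fun s => ζ (τ j s)) + fun s => H fun j => (τ j s : G ⧸ C.1) := by
        ext s
        simpa [Finset.sum_apply] using hlH (fun i => τ i s) fun i => (hτ i).mk_eq_one hF hv s _
      rw [hrw]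
      refine Submodule.add_mem _ (Submodule.sum_mem _ fun j _ => Submodule.smul_mem _ _ (ih j)) ?_
      refine degreeLE_mono ((Nat.mul_le_mul_right d (hm₀ _ hf)).trans (le_max_right _ _))
        (comp_pi_mem_degreeLE (fun j φ => hd k _ (hτ j) φ) H)
  refine ⟨d + (p - 1) * d', fun k τ hτ φ => ?_⟩
  classical
  let H : G ⧸ C.1 → ZMod p → ZMod p := fun q a =>
    if hq : ∃ x : G, (x : G ⧸ C.1) = q ∧ ζ x = a then φ (hq.choose : G) else 0
  have hrw : (fun s => φ (τ s)) = fun s => H (τ s) (ζ (τ s)) := by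
    ext s
    have hq : ∃ x : G, (x : G ⧸ C.1) = τ s ∧ ζ x = ζ (τ s) := ⟨_, rfl, rfl⟩
    simp only [H, dif_pos hq]
    rw [hζ.mk_eq hq.choose_spec.1 hq.choose_spec.2]
  rw [hrw]
  exact comp_prod_mem_degreeLE (hd k τ hτ) (comp_zmod_mem_degreeLE (hdeg k τ hτ)) H

theorem BoundedDegree.descend [Finite G] (hp : p.Prime) (hG : IsPGroup p G)
    (hFfin : F.Finite) (hF : ∀ f ∈ F, Compatible f.2) {A : {H : Subgroup G // H.Normal}}
    (hAB : A ≤ B) {v : G} (hv : v ∈ B.1)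
    (hcen : ∀ C' C, A ≤ C' → C' ⋖ C → C ≤ B → Centralizes B C' C) :
    BoundedDegree p F v A := by
  obtain ⟨C, ⟨⟨hAC, hCB, hC⟩, hmin⟩⟩ := exists_minimal_of_wellFoundedLT
    (fun C => A ≤ C ∧ C ≤ B ∧ BoundedDegree p F v C) ⟨B, hAB, le_rfl, .of_mem hF hv⟩
  rcases eq_or_lt_of_le hAC with rfl | hlt
  · exact hC
  obtain ⟨C', hAC', hcov⟩ := exists_le_covBy_of_lt hlt
  exact absurd (hmin ⟨hAC', hcov.le.trans hCB,
    hC.of_centralizes hp hG hFfin hF hv hcov hCB (hcen C' C hAC' hcov hCB)⟩ hcov.le) hcov.lt.not_ge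

open Classical in
/-- The conjunction with respect to a splitting pair: it takes the value `e` if no argument lies in
`δ`, and `1` otherwise. -/
noncomputable def conjunction (δ : {H : Subgroup G // H.Normal}) (e : G) (k : ℕ)
    (x : Fin k → G) : G := if ∀ j, x j ∉ δ.1 then e else 1

theorem compatible_conjunction {δ ε : {H : Subgroup G // H.Normal}} {e : G}
    (h : ∀ K : {H : Subgroup G // H.Normal}, K ≤ δ ∨ ε ≤ K) (he : e ∈ ε.1) (k : ℕ) :
    Compatible (conjunction δ e k) := by
  intro N hN a b hab
  rcases h ⟨N, hN⟩ with hNδ | hεN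
  · have : ∀ j, a j ∉ δ.1 ↔ b j ∉ δ.1 := fun j => by
      rw [← δ.1.mul_mem_cancel_right (hNδ (hab j)), mul_inv_cancel_left]
    have hab' : conjunction δ e k a = conjunction δ e k b := by
      by_cases hb : ∀ j, b j ∉ δ.1
      · exact (if_pos ((forall_congr' this).2 hb)).trans (if_pos hb).symm
      · exact (if_neg (mt (forall_congr' this).1 hb)).trans (if_neg hb).symm
    rw [hab', inv_mul_cancel]
    exact N.one_mem
  · have hmem : ∀ x, conjunction δ e k x ∈ N := fun x => by
      unfold conjunction
      split_ifs
      exacts [hεN he, N.one_mem]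
    exact N.mul_mem (N.inv_mem (hmem a)) (hmem b)

theorem not_compFG_of_splitting [Finite G] (hp : p.Prime) (hG : IsPGroup p G)
    {A M δ ε : {H : Subgroup G // H.Normal}} (hA : Cuts A) (hB : Cuts B) (hcut : NoInnerCut A B)
    (hAM : A < M) (hMB : M < B) (hAδ : A ≤ δ) (hδB : δ < B) (hAε : A < ε) (hεB : ε ≤ B)
    (hs : ∀ K, A ≤ K → K ≤ B → K ≤ δ ∨ ε ≤ K) : ¬ CompFG G := by
  rintro ⟨F, hFfin, hF, hclone⟩
  have := Fact.mk hp
  have hs' : ∀ K : {H : Subgroup G // H.Normal}, K ≤ δ ∨ ε ≤ K := fun K => by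
    rcases hA K with h | h
    · exact .inl (h.trans hAδ)
    rcases hB K with h' | h'
    · exact hs K h h'
    · exact .inr (hεB.trans h')
  have h3 := coversHaveThird_normalSubgroup hp hG
  obtain ⟨v, hv, hvδ⟩ := SetLike.exists_of_lt (show δ.1 < B.1 from hδB)
  obtain ⟨e, he, heA⟩ := SetLike.exists_of_lt (show A.1 < ε.1 from hAε)
  obtain ⟨d, hd⟩ := BoundedDegree.descend hp hG hFfin (fun f hf => (hF f hf).2)
    (hAM.le.trans hMB.le) hv fun C' C h1 h2 h4 =>
      centralizes_of_covBy_of_noInnerCut h3 hcut hAM hMB h1 h2 h4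
  have hmem := (hclone (d + 1) (by omega) _).1 (compatible_conjunction hs' he (d + 1))
  classical
  have := hd (d + 1) _ (hmem.reachable (γ := cubeVertex v) fun j => .base j)
    fun q => if q = (e : G ⧸ A.1) then 1 else 0
  refine conjunction_notMem_degreeLE (R := ZMod p) (ι := Fin (d + 1)) (d := d) (by simp) ?_
  convert this using 2 with s
  have h1 : ∀ j, cubeVertex v j s ∉ δ.1 ↔ s j = true := fun j => by
    unfold cubeVertex
    split_ifs with hj
    · simp [hj, hvδ]
    · simp [hj, δ.1.one_mem]
  simp only [conjunction, h1]
  split_ifs with h2 h4 h5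
  · rfl
  · exact absurd rfl h4
  · rw [eq_comm, QuotientGroup.mk_one, QuotientGroup.eq_one_iff] at h5
    exact absurd h5 heA
  · rfl

end Necessity

/-- Theorem (p-groups): Let `G` be a finite `p`-group and let
`⊥ = N 0 < ⋯ < N n = ⊤` enumerate the cutting elements of the lattice of
normal subgroups.  Then `Comp G` is finitely generated iff each interval
`I[N i, N (i+1)]` has exactly two elements or does not split. -/
theorem compFG_iff_of_pGroup (p : ℕ) (hp : p.Prime) (G : Type*) [Group G] [Finite G]
    (hpG : IsPGroup p G) (n : ℕ) (N : Fin (n + 1) → {H : Subgroup G // H.Normal})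
    (hmono : StrictMono N) (h0 : N 0 = ⊥) (hlast : N (Fin.last n) = ⊤)
    (hcuts : ∀ i, Cuts (N i)) (hall : ∀ M : {H : Subgroup G // H.Normal}, Cuts M → ∃ i, M = N i) :
    CompFG G ↔ ∀ i : Fin n,
      (∀ K : {H : Subgroup G // H.Normal}, N i.castSucc ≤ K → K ≤ N i.succ →
          K = N i.castSucc ∨ K = N i.succ)
        ∨ ¬ IntervalSplits (N i.castSucc) (N i.succ) := by
  refine ⟨fun hfg i => ?_, compFG_of_intervals N hmono h0 hlast hcuts⟩
  by_contra! hi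
  obtain ⟨⟨M, hAM, hMB, hMA, hMB'⟩, δ, ε, hAδ, hδB, hAε, hεB, hs⟩ := hi
  have hcut : NoInnerCut (N i.castSucc) (N i.succ) := by
    intro z hz hz'
    have hzc : ¬ Cuts z := by
      intro hc
      obtain ⟨j, rfl⟩ := hall z hc
      have h1 := hmono.lt_iff_lt.1 hz
      have h2 := hmono.lt_iff_lt.1 hz'
      simp only [Fin.lt_def, Fin.val_castSucc, Fin.val_succ] at h1 h2
      omega
    simp only [Cuts, not_forall, not_or] at hzc
    obtain ⟨k, hk, hk'⟩ := hzc
    exact ⟨k, ((hcuts i.castSucc k).resolve_left fun h => hk (h.trans hz.le)),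
      ((hcuts i.succ k).resolve_right fun h => hk' (hz'.le.trans h)), hk, hk'⟩
  exact not_compFG_of_splitting hp hpG (hcuts _) (hcuts _) hcut (lt_of_le_of_ne hAM hMA.symm)
    (lt_of_le_of_ne hMB hMB') hAδ hδB hAε hεB hs hfg
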